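/- arXiv:2302.02836 — 6 statements merged into one kernel-verified Lean document; each statement's English description precedes it below -/
import Mathlib

section
/- Absorbing lemma: let T > 0 and let y : [0,T] → [0,∞) be continuous with y(0) = 0. Suppose there are constants a, b, c > 0 with b + 2ac < 1/4 such that for all t ∈ [0,T] one has sup_{s∈[0,t]} y(s) ≤ a·(sup_{s∈[0,t]} y(s))² + b·sup_{s∈[0,t]} y(s) + c. Then sup_{s∈[0,T]} y(s) < 2c. -/
/-- Absorbing lemma: if `y : [0,T] → [0,∞)` is continuous, `y 0 = 0`, and for constants
`a, b, c > 0` with `b + 2ac < 1/4` the running supremum `sup_{[0,t]} y` satisfies the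
quadratic inequality `sup ≤ a·sup² + b·sup + c` for all `t ∈ [0,T]`, then
`sup_{[0,T]} y < 2c`. -/
theorem stmt_2 (T : ℝ) (hT : 0 < T) (y : ℝ → ℝ)
    (hy : ContinuousOn y (Set.Icc 0 T)) (hy0 : y 0 = 0)
    (hnn : ∀ s ∈ Set.Icc 0 T, 0 ≤ y s)
    (a b c : ℝ) (ha : 0 < a) (hb : 0 < b) (hc : 0 < c)
    (hsmall : b + 2 * a * c < 1/4)
    (hineq : ∀ t ∈ Set.Icc 0 T,
      sSup (y '' Set.Icc 0 t) ≤
        a * (sSup (y '' Set.Icc 0 t))^2 + b * sSup (y '' Set.Icc 0 t) + c) :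
    sSup (y '' Set.Icc 0 T) < 2 * c := by
  by_contra hcon
  push Not at hcon
  have hne : (Set.Icc (0:ℝ) T).Nonempty := ⟨0, le_refl _, hT.le⟩
  obtain ⟨x, hx, hxe⟩ := isCompact_Icc.exists_sSup_image_eq hne hy
  have key : ∀ s ∈ Set.Icc (0:ℝ) T, 2 * c ≤ y s → ∃ r ∈ Set.Icc (0:ℝ) s, y r = 2 * c := by
    intro s hs h
    have hsub : Set.Icc (0:ℝ) s ⊆ Set.Icc 0 T := Set.Icc_subset_Icc_right hs.2
    have h2 := intermediate_value_Icc hs.1 (hy.mono hsub)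
    have h3 : 2 * c ∈ Set.Icc (y 0) (y s) := ⟨by rw [hy0]; linarith, h⟩
    obtain ⟨r, hr, hre⟩ := h2 h3
    exact ⟨r, hr, hre⟩
  have hcpt : IsCompact (Set.Icc (0:ℝ) T ∩ y ⁻¹' {2 * c}) :=
    isCompact_Icc.of_isClosed_subset
      (hy.preimage_isClosed_of_isClosed isClosed_Icc isClosed_singleton) Set.inter_subset_left
  obtain ⟨r, hr, hre⟩ := key x hx (by rw [← hxe]; exact hcon)
  obtain ⟨t, ⟨ht, hte⟩, hmin⟩ := hcpt.exists_isLeast ⟨r, ⟨hr.1, hr.2.trans hx.2⟩, hre⟩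
  have hte' : y t = 2 * c := hte
  have hsup : sSup (y '' Set.Icc 0 t) = 2 * c := by
    apply IsGreatest.csSup_eq
    refine ⟨⟨t, ⟨ht.1, le_refl _⟩, hte'⟩, ?_⟩
    rintro _ ⟨s, hs, rfl⟩
    by_contra hlt
    push Not at hlt
    obtain ⟨q, hq, hqe⟩ := key s ⟨hs.1, hs.2.trans ht.2⟩ hlt.le
    have h1 : t ≤ q := hmin ⟨⟨hq.1, hq.2.trans (hs.2.trans ht.2)⟩, hqe⟩
    have h2 : s = t := le_antisymm hs.2 (h1.trans hq.2)
    rw [h2, hte'] at hlt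
    exact lt_irrefl _ hlt
  have h := hineq t ht
  rw [hsup] at h
  nlinarith [mul_lt_mul_of_pos_left hsmall hc]
end

section
/- 2.75D shear flows solve the 3D Euler equations: let λ ∈ ℝ, let f : ℝ² → ℝ be continuously differentiable and g : ℝ → ℝ be differentiable. Define u : ℝ × ℝ³ → ℝ³ by u(t,x) = ( f(λx₁+x₂+t g(x₃), x₃), −λ f(λx₁+x₂+t g(x₃), x₃) − g(x₃), 0 ). Then for all (t,x) ∈ ℝ × ℝ³: (i) ∑_{k=1}^3 ∂_{x_k} u_k(t,x) = 0 (incompressibility), and (ii) for each i ∈ {1,2,3}, ∂_t u_i(t,x) + ∑_{k=1}^3 u_k(t,x) ∂_{x_k} u_i(t,x) = 0 (the incompressible Euler equations with constant pressure). -/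
/-- Partial derivative in the `k`-th coordinate direction of a function on `ℝ³`. -/
noncomputable def pd (u : (Fin 3 → ℝ) → ℝ) (k : Fin 3) (x : Fin 3 → ℝ) : ℝ :=
  deriv (fun s => u (Function.update x k s)) (x k)

/-- The 2.75D shear flow velocity field
`u(t,x) = (f(λx₁+x₂+t g(x₃), x₃), -λ f(λx₁+x₂+t g(x₃), x₃) - g(x₃), 0)`. -/
noncomputable def shearEuler (lam : ℝ) (f : ℝ → ℝ → ℝ) (g : ℝ → ℝ)
    (t : ℝ) (x : Fin 3 → ℝ) : Fin 3 → ℝ :=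
  ![f (lam * x 0 + x 1 + t * g (x 2)) (x 2),
    -lam * f (lam * x 0 + x 1 + t * g (x 2)) (x 2) - g (x 2),
    0]

/-- 2.75D shear flows solve the 3D incompressible Euler equations with constant
pressure: they are divergence free and satisfy `∂_t u_i + ∑_k u_k ∂_k u_i = 0`. -/
theorem stmt_6 (lam : ℝ) (f : ℝ → ℝ → ℝ) (g : ℝ → ℝ)
    (hf : ContDiff ℝ 1 (fun p : ℝ × ℝ => f p.1 p.2))
    (hg : Differentiable ℝ g) (t : ℝ) (x : Fin 3 → ℝ) :
    (∑ k : Fin 3, pd (fun y => shearEuler lam f g t y k) k x = 0) ∧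
    (∀ i : Fin 3,
      deriv (fun s => shearEuler lam f g s x i) t +
        ∑ k : Fin 3,
          shearEuler lam f g t x k * pd (fun y => shearEuler lam f g t y i) k x = 0) := by
  obtain ⟨D, hD⟩ : ∃ D, HasDerivAt (fun s => f s (x 2)) D (lam * x 0 + x 1 + t * g (x 2)) := by
    have h1 : Differentiable ℝ (fun s : ℝ => f s (x 2)) :=
      (hf.differentiable (by norm_num)).comp
        (g := fun p : ℝ × ℝ => f p.1 p.2) (f := fun s : ℝ => (s, x 2)) (by fun_prop)
    exact ⟨_, (h1 _).hasDerivAt⟩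
  have h0 : HasDerivAt (fun s => f (lam * s + x 1 + t * g (x 2)) (x 2)) (D * lam) (x 0) := by
    have h2 : HasDerivAt (fun s => lam * s + x 1 + t * g (x 2)) lam (x 0) := by
      simpa using (((hasDerivAt_id (x 0)).const_mul lam).add_const (x 1)).add_const (t * g (x 2))
    exact HasDerivAt.comp (x 0) (h₂ := fun s => f s (x 2)) hD h2
  have h1 : HasDerivAt (fun s => f (lam * x 0 + s + t * g (x 2)) (x 2)) D (x 1) := by
    have h2 : HasDerivAt (fun s => lam * x 0 + s + t * g (x 2)) 1 (x 1) := by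
      simpa using ((hasDerivAt_id (x 1)).const_add (lam * x 0)).add_const (t * g (x 2))
    have h3 := HasDerivAt.comp (x 1) (h₂ := fun s => f s (x 2)) hD h2
    rw [mul_one] at h3
    exact h3
  have ht : HasDerivAt (fun s => f (lam * x 0 + x 1 + s * g (x 2)) (x 2)) (D * g (x 2)) t := by
    have h2 : HasDerivAt (fun s => lam * x 0 + x 1 + s * g (x 2)) (g (x 2)) t := by
      simpa using ((hasDerivAt_id t).mul_const (g (x 2))).const_add (lam * x 0 + x 1)
    exact HasDerivAt.comp t (h₂ := fun s => f s (x 2)) hD h2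
  have p00 : pd (fun y => shearEuler lam f g t y 0) 0 x = D * lam := by
    simpa [pd, shearEuler] using h0.deriv
  have p01 : pd (fun y => shearEuler lam f g t y 0) 1 x = D := by
    simpa [pd, shearEuler] using h1.deriv
  have p10 : pd (fun y => shearEuler lam f g t y 1) 0 x = -lam * (D * lam) := by
    simpa [pd, shearEuler] using ((h0.const_mul (-lam)).sub_const (g (x 2))).deriv
  have p11 : pd (fun y => shearEuler lam f g t y 1) 1 x = -lam * D := by
    simpa [pd, shearEuler] using ((h1.const_mul (-lam)).sub_const (g (x 2))).deriv
  have p2 : ∀ k, pd (fun y => shearEuler lam f g t y 2) k x = 0 := by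
    intro k
    simp [pd, shearEuler]
  have t0 : deriv (fun s => shearEuler lam f g s x 0) t = D * g (x 2) := by
    simpa [shearEuler] using ht.deriv
  have t1 : deriv (fun s => shearEuler lam f g s x 1) t = -lam * (D * g (x 2)) := by
    simpa [shearEuler] using ((ht.const_mul (-lam)).sub_const (g (x 2))).deriv
  have t2 : deriv (fun s => shearEuler lam f g s x 2) t = 0 := by
    simp [shearEuler]
  have e0 : shearEuler lam f g t x 0 = f (lam * x 0 + x 1 + t * g (x 2)) (x 2) := rfl
  have e1 : shearEuler lam f g t x 1 =
    -lam * f (lam * x 0 + x 1 + t * g (x 2)) (x 2) - g (x 2) := rfl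
  have e2 : shearEuler lam f g t x 2 = 0 := rfl
  refine ⟨?_, ?_⟩
  · rw [Fin.sum_univ_three, p00, p11, p2]; ring
  · rw [Fin.forall_fin_succ, Fin.forall_fin_succ, Fin.forall_fin_succ]
    refine ⟨?_, ?_, ?_, fun i => i.elim0⟩
    · rw [Fin.sum_univ_three, t0, p00, p01, e0, e1, e2]; ring
    · change deriv (fun s => shearEuler lam f g s x 1) t + ∑ k : Fin 3,
          shearEuler lam f g t x k * pd (fun y => shearEuler lam f g t y 1) k x = 0
      rw [Fin.sum_univ_three, t1, p10, p11, e0, e1, e2]; ring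
    · change deriv (fun s => shearEuler lam f g s x 2) t + ∑ k : Fin 3,
          shearEuler lam f g t x k * pd (fun y => shearEuler lam f g t y 2) k x = 0
      rw [Fin.sum_univ_three, t2, p2, p2, p2]; ring
end

section
/- 2.75D shear flows solve the 3D Navier–Stokes equations: let ν > 0, λ ∈ ℝ. Let G : ℝ × ℝ → ℝ be twice continuously differentiable and satisfy the heat equation ∂_t G(t,z) = ν ∂_z² G(t,z) for all (t,z). Let F : ℝ × ℝ² → ℝ be twice continuously differentiable and satisfy the drift–diffusion equation ∂_t F(t,y₁,y₂) − G(t,y₂) ∂_{y₁} F(t,y₁,y₂) = ν( (λ²+1) ∂_{y₁}² F + ∂_{y₂}² F )(t,y₁,y₂) for all (t,y₁,y₂). Define u : ℝ × ℝ³ → ℝ³ by u(t,x) = ( F(t, λx₁+x₂, x₃), −λ F(t, λx₁+x₂, x₃) − G(t,x₃), 0 ). Then for all (t,x): (i) ∑_{k=1}^3 ∂_{x_k} u_k(t,x) = 0, and (ii) for each i ∈ {1,2,3}, ∂_t u_i + ∑_{k=1}^3 u_k ∂_{x_k} u_i = ν ∑_{k=1}^3 ∂_{x_k}² u_i at (t,x)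 (the incompressible Navier–Stokes equations with constant pressure). -/
/-- The viscous 2.75D shear flow velocity field
`u(t,x) = (F(t, λx₁+x₂, x₃), -λ F(t, λx₁+x₂, x₃) - G(t,x₃), 0)`. -/
noncomputable def shearNS (lam : ℝ) (F : ℝ → ℝ → ℝ → ℝ) (G : ℝ → ℝ → ℝ)
    (t : ℝ) (x : Fin 3 → ℝ) : Fin 3 → ℝ :=
  ![F t (lam * x 0 + x 1) (x 2),
    -lam * F t (lam * x 0 + x 1) (x 2) - G t (x 2),
    0]

theorem pd_slice (x : Fin 3 → ℝ) (k : Fin 3) (s : ℝ) :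
    HasDerivAt (fun s => Function.update x k s) (Pi.single k (1:ℝ)) s := hasDerivAt_update x k s

theorem pd_eq (f : (Fin 3 → ℝ) → ℝ) (hf : Differentiable ℝ f) (k : Fin 3) :
    pd f k = fun x => fderiv ℝ f x (Pi.single k 1) := by
  funext x
  unfold pd
  have h := (hf (Function.update x k (x k))).hasFDerivAt.comp_hasDerivAt (x k) (pd_slice x k (x k))
  have h2 := h.deriv
  rw [Function.update_eq_self] at h2
  exact h2

theorem pd_diff (f : (Fin 3 → ℝ) → ℝ) (hf : ContDiff ℝ 2 f) (k : Fin 3) :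
    Differentiable ℝ (pd f k) := by
  rw [pd_eq f (hf.differentiable (by norm_num))]
  have h : ContDiff ℝ 1 (fderiv ℝ f) := hf.fderiv_right (by norm_num)
  have h2 := h.differentiable (by norm_num)
  fun_prop

theorem pd_lin (f g : (Fin 3 → ℝ) → ℝ) (hf : Differentiable ℝ f) (hg : Differentiable ℝ g)
    (a : ℝ) (k : Fin 3) :
    pd (fun y => a * f y - g y) k = fun y => a * pd f k y - pd g k y := by
  rw [pd_eq f hf, pd_eq g hg, pd_eq _ (by fun_prop)]
  funext x
  rw [fderiv_fun_sub ((hf x).const_mul a) (hg x), fderiv_const_mul (hf x)]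
  simp

theorem deriv_aff (H : ℝ → ℝ) (l c s : ℝ) :
    deriv (fun s => H (l * s + c)) s = l * deriv H (l * s + c) := by
  have := deriv_comp_mul_left l (fun s => H (s + c)) s
  simpa [deriv_comp_add_const] using this

theorem pdF0 (l : ℝ) (H : ℝ → ℝ → ℝ) :
    pd (fun y => H (l * y 0 + y 1) (y 2)) 0 =
      fun y => l * deriv (fun s => H s (y 2)) (l * y 0 + y 1) := by
  funext y
  simpa [pd] using deriv_aff (fun s => H s (y 2)) l (y 1) (y 0)

theorem pdF1 (l : ℝ) (H : ℝ → ℝ → ℝ) :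
    pd (fun y => H (l * y 0 + y 1) (y 2)) 1 =
      fun y => deriv (fun s => H s (y 2)) (l * y 0 + y 1) := by
  funext y
  simpa [pd] using deriv_comp_const_add (fun s => H s (y 2)) (l * y 0) (y 1)

theorem pdF2 (l : ℝ) (H : ℝ → ℝ → ℝ) :
    pd (fun y => H (l * y 0 + y 1) (y 2)) 2 =
      fun y => deriv (fun s => H (l * y 0 + y 1) s) (y 2) := by
  funext y
  simp [pd]

theorem pdG (H : ℝ → ℝ) : pd (fun y => H (y 2)) 0 = (fun _ => 0) ∧
    pd (fun y => H (y 2)) 1 = (fun _ => 0) ∧ pd (fun y => H (y 2)) 2 = fun y => deriv H (y 2) := by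
  refine ⟨?_, ?_, ?_⟩ <;> funext y <;> simp [pd]

/-- 2.75D shear flows solve the 3D incompressible Navier–Stokes equations with constant
pressure: if `G` solves the 1D heat equation `∂_t G = ν ∂_z² G` and `F` solves the
drift–diffusion equation `∂_t F - G ∂_{y₁} F = ν((λ²+1)∂_{y₁}² F + ∂_{y₂}² F)`, then the
associated shear flow is divergence free and satisfies
`∂_t u_i + ∑_k u_k ∂_k u_i = ν ∑_k ∂_k² u_i`. -/
theorem stmt_7 (ν lam : ℝ) (hν : 0 < ν) (G : ℝ → ℝ → ℝ) (F : ℝ → ℝ → ℝ → ℝ)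
    (hG : ContDiff ℝ 2 (fun p : ℝ × ℝ => G p.1 p.2))
    (hF : ContDiff ℝ 2 (fun p : ℝ × ℝ × ℝ => F p.1 p.2.1 p.2.2))
    (hheat : ∀ t z : ℝ, deriv (fun s => G s z) t = ν * deriv (deriv (G t)) z)
    (hdrift : ∀ t y₁ y₂ : ℝ,
      deriv (fun s => F s y₁ y₂) t - G t y₂ * deriv (fun s => F t s y₂) y₁ =
        ν * ((lam^2 + 1) * deriv (deriv (fun s => F t s y₂)) y₁ +
          deriv (deriv (fun s => F t y₁ s)) y₂))
    (t : ℝ) (x : Fin 3 → ℝ) :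
    (∑ k : Fin 3, pd (fun y => shearNS lam F G t y k) k x = 0) ∧
    (∀ i : Fin 3,
      deriv (fun s => shearNS lam F G s x i) t +
        ∑ k : Fin 3,
          shearNS lam F G t x k * pd (fun y => shearNS lam F G t y i) k x =
        ν * ∑ k : Fin 3, pd (fun y => pd (fun z => shearNS lam F G t z i) k y) k x) := by
  have hf : ContDiff ℝ 2 (fun y : Fin 3 → ℝ => F t (lam * y 0 + y 1) (y 2)) :=
    hF.comp (g := fun p : ℝ × ℝ × ℝ => F p.1 p.2.1 p.2.2)
      (f := fun y : Fin 3 → ℝ => (t, lam * y 0 + y 1, y 2)) (by fun_prop)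
  have hg : ContDiff ℝ 2 (fun y : Fin 3 → ℝ => G t (y 2)) :=
    hG.comp (g := fun p : ℝ × ℝ => G p.1 p.2)
      (f := fun y : Fin 3 → ℝ => (t, y 2)) (by fun_prop)
  have hFt : DifferentiableAt ℝ (fun s => F s (lam * x 0 + x 1) (x 2)) t :=
    ((hF.comp (g := fun p : ℝ × ℝ × ℝ => F p.1 p.2.1 p.2.2)
      (f := fun s : ℝ => (s, lam * x 0 + x 1, x 2)) (by fun_prop)).differentiable
        (by norm_num)) t
  have hGt : DifferentiableAt ℝ (fun s => G s (x 2)) t :=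
    ((hG.comp (g := fun p : ℝ × ℝ => G p.1 p.2)
      (f := fun s : ℝ => (s, x 2)) (by fun_prop)).differentiable (by norm_num)) t
  have e1 : ∀ k, pd (fun y => -lam * F t (lam * y 0 + y 1) (y 2) - G t (y 2)) k = _ :=
    fun k => pd_lin _ _ (hf.differentiable (by norm_num)) (hg.differentiable (by norm_num)) (-lam) k
  have e2 : ∀ k, pd (pd (fun y => -lam * F t (lam * y 0 + y 1) (y 2) - G t (y 2)) k) k = _ :=
    fun k => (congrArg (fun q => pd q k) (e1 k)).trans
      (pd_lin _ _ (pd_diff _ hf k) (pd_diff _ hg k) (-lam) k)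
  obtain ⟨g0, g1, g2⟩ := pdG (G t)
  obtain ⟨-, -, g22⟩ := pdG (deriv (G t))
  have z : ∀ k, pd (fun _ => (0:ℝ)) k = fun _ => 0 := by
    intro k; funext y; simp [pd]
  have f0 := pdF0 lam (F t)
  have f1 := pdF1 lam (F t)
  have f2 := pdF2 lam (F t)
  have f00 := pdF0 lam (fun a b => lam * deriv (fun s => F t s b) a)
  have f11 := pdF1 lam (fun a b => deriv (fun s => F t s b) a)
  have f22 := pdF2 lam (fun a b => deriv (fun s => F t a s) b)
  simp only [deriv_const_mul_field] at f00
  have hd := hdrift t (lam * x 0 + x 1) (x 2)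
  have hh := hheat t (x 2)
  refine ⟨?_, ?_⟩
  · simp only [Fin.sum_univ_three, shearNS, Matrix.cons_val]
    rw [e1, z, f0, f1, g1]
    ring
  · intro i
    fin_cases i
    · simp only [Fin.sum_univ_three, shearNS, Matrix.cons_val, Fin.zero_eta]
      change _ = ν * (pd (pd _ 0) 0 x + pd (pd _ 1) 1 x + pd (pd _ 2) 2 x)
      rw [f0, f1, f2, f00, f11, f22]
      linear_combination hd
    · simp only [Fin.sum_univ_three, shearNS, Matrix.cons_val, Fin.mk_one]
      change _ = ν * (pd (pd _ 0) 0 x + pd (pd _ 1) 1 x + pd (pd _ 2) 2 x)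
      rw [e2, e2, e2, e1, e1, e1, f0, f1, f2, f00, f11, f22, g0, g1, g2, g22, z, z,
        deriv_fun_sub (hFt.const_mul _) hGt, deriv_const_mul _ hFt]
      linear_combination (-lam) * hd - hh
    · simp [Fin.sum_univ_three, shearNS, z]
end

section
/- Energy of the Kolmogorov-perturbed Euler flow is conserved and explicit: let λ ∈ ℤ and for t ∈ ℝ define u(t,x) = ( sin(λx₁+x₂−t sin x₃), −λ sin(λx₁+x₂−t sin x₃) + sin x₃, 0 ) for x ∈ ℝ³. Then for every t ∈ ℝ, ∫_{[0,2π]³} |u(t,x)|² dx = 4π³ (λ² + 2). In particular the L² norm of u(t,·) over [0,2π]³ is independent of t and differs from that of the Kolmogorov flow (0, sin x₃, 0), whose squared L² norm over [0,2π]³ is 4π³. -/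
open Real MeasureTheory

lemma inner_int (l c s : ℝ) : (∫ x in (0:ℝ)..(2*π),
    ((Real.sin (x + c))^2 + (-l * Real.sin (x + c) + s)^2 + (0:ℝ)^2))
      = π * (1 + l^2) + 2 * π * s^2 := by
  have h : ∀ x ∈ Set.uIcc (0:ℝ) (2*π), HasDerivAt
      (fun x => (1 + l^2) * ((x - Real.sin (x + c) * Real.cos (x + c)) / 2)
        + 2 * l * s * Real.cos (x + c) + s^2 * x)
      ((Real.sin (x + c))^2 + (-l * Real.sin (x + c) + s)^2 + (0:ℝ)^2) x := by
    intro x _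
    have h0 : HasDerivAt (fun x : ℝ => x + c) 1 x := (hasDerivAt_id x).add_const c
    have h1 := h0.sin
    have h2 := h0.cos
    have h3 := (((((hasDerivAt_id x).sub (h1.mul h2)).div_const 2).const_mul (1 + l^2)).add
      (h2.const_mul (2 * l * s))).add ((hasDerivAt_id x).const_mul (s^2))
    refine h3.congr_deriv ?_
    have := Real.sin_sq_add_cos_sq (x + c)
    linear_combination (-(1 + l^2) / 2) * this
  rw [intervalIntegral.integral_eq_sub_of_hasDerivAt h
    (Continuous.intervalIntegrable (by fun_prop) _ _)]
  have e1 : Real.sin (2 * π + c) = Real.sin c := by rw [add_comm, Real.sin_add_two_pi]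
  have e2 : Real.cos (2 * π + c) = Real.cos c := by rw [add_comm, Real.cos_add_two_pi]
  rw [e1, e2, zero_add]
  ring

lemma outer_int (a b : ℝ) : (∫ x in (0:ℝ)..(2*π), (a + b * (Real.sin x)^2))
      = 2 * π * a + b * π := by
  rw [intervalIntegral.integral_add (Continuous.intervalIntegrable (by fun_prop) _ _)
    (Continuous.intervalIntegrable (by fun_prop) _ _), intervalIntegral.integral_const_mul,
    integral_sin_sq]
  simp

open Real MeasureTheory

/-- The energy of the Kolmogorov-perturbed Euler flow
`u(t,x) = (sin(λx₁+x₂-t sin x₃), -λ sin(λx₁+x₂-t sin x₃) + sin x₃, 0)` over `[0,2π]³` is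
independent of `t` and equals `4π³(λ²+2)`, while the squared `L²` norm of the Kolmogorov
flow `(0, sin x₃, 0)` over `[0,2π]³` is `4π³`. -/
theorem stmt_9 (lam : ℤ) (t : ℝ) :
    (∫ x₃ in (0:ℝ)..(2*π), ∫ x₂ in (0:ℝ)..(2*π), ∫ x₁ in (0:ℝ)..(2*π),
        ((Real.sin ((lam:ℝ)*x₁ + x₂ - t * Real.sin x₃))^2 +
          (-(lam:ℝ) * Real.sin ((lam:ℝ)*x₁ + x₂ - t * Real.sin x₃) + Real.sin x₃)^2 +
          (0:ℝ)^2)) = 4 * π^3 * ((lam:ℝ)^2 + 2) ∧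
    (∫ x₃ in (0:ℝ)..(2*π), ∫ x₂ in (0:ℝ)..(2*π), ∫ x₁ in (0:ℝ)..(2*π),
        ((0:ℝ)^2 + (Real.sin x₃)^2 + (0:ℝ)^2)) = 4 * π^3 := by
  constructor
  · have key : ∀ x₃ : ℝ, (∫ x₂ in (0:ℝ)..(2*π), ∫ x₁ in (0:ℝ)..(2*π),
        ((Real.sin ((lam:ℝ)*x₁ + x₂ - t * Real.sin x₃))^2 +
          (-(lam:ℝ) * Real.sin ((lam:ℝ)*x₁ + x₂ - t * Real.sin x₃) + Real.sin x₃)^2 +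
          (0:ℝ)^2)) = 2 * π * (π * (1 + (lam:ℝ)^2)) + (4 * π^2) * (Real.sin x₃)^2 := by
      intro x₃
      rw [intervalIntegral_intervalIntegral_swap]
      · have : ∀ x₁ : ℝ, (∫ x₂ in (0:ℝ)..(2*π),
          ((Real.sin ((lam:ℝ)*x₁ + x₂ - t * Real.sin x₃))^2 +
          (-(lam:ℝ) * Real.sin ((lam:ℝ)*x₁ + x₂ - t * Real.sin x₃) + Real.sin x₃)^2 +
          (0:ℝ)^2)) = π * (1 + (lam:ℝ)^2) + 2 * π * (Real.sin x₃)^2 := by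
          intro x₁
          rw [← inner_int (lam:ℝ) ((lam:ℝ)*x₁ - t * Real.sin x₃) (Real.sin x₃)]
          congr 1
          ext x
          rw [show (lam:ℝ)*x₁ + x - t * Real.sin x₃ = x + ((lam:ℝ)*x₁ - t * Real.sin x₃) by ring]
        simp_rw [this]
        rw [intervalIntegral.integral_const, smul_eq_mul]
        ring
      · refine IntegrableOn.mono_set (t := Set.uIcc (0:ℝ) (2*π) ×ˢ Set.uIcc (0:ℝ) (2*π)) ?_
          (Set.prod_mono Set.uIoc_subset_uIcc Set.uIoc_subset_uIcc)
        refine ContinuousOn.integrableOn_compact (isCompact_uIcc.prod isCompact_uIcc) ?_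
        refine Continuous.continuousOn ?_
        unfold Function.uncurry
        fun_prop
    simp_rw [key]
    rw [outer_int]
    ring
  · have h := outer_int 0 (4 * π^2)
    simp only [intervalIntegral.integral_const, smul_eq_mul]
    rw [show 4 * π^3 = 2 * π * 0 + 4 * π^2 * π by ring, ← h]
    congr 1
    ext x
    ring
end

section
/- Weak convergence to the Kolmogorov flow: let λ ∈ ℤ and let φ : ℝ³ → ℝ be integrable on the cube [0,2π]³. Then ∫_{[0,2π]³} sin(λx₁ + x₂ + t cos x₃) φ(x) dx → 0 as t → ∞. -/
open Real MeasureTheory Filter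

lemma aux_A (s : Set ℝ) (hs : MeasurableSet s) (hi : Set.InjOn Real.cos s)
    (h0 : ∀ x ∈ s, Real.sin x ≠ 0) (f : ℝ → ℂ) :
    Tendsto (fun t : ℝ => ∫ x in s, Complex.exp ((t * Real.cos x : ℝ) * Complex.I) * f x)
      atTop (nhds 0) := by
  set g : ℝ → ℝ := Function.invFunOn Real.cos s with hg
  have hgl : ∀ x ∈ s, g (Real.cos x) = x := fun x hx => hi.leftInvOn_invFunOn hx
  have him : MeasurableSet (Real.cos '' s) :=
    hs.image_of_continuousOn_injOn Real.continuous_cos.continuousOn hi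
  set F : ℝ → ℂ := (Real.cos '' s).indicator (fun u => (|Real.sin (g u)|⁻¹ : ℝ) • f (g u)) with hF
  have hRL := Real.tendsto_integral_exp_smul_cocompact F
  have hw : Tendsto (fun t : ℝ => -(t / (2 * π))) atTop (cocompact ℝ) := by
    have : Tendsto (fun t : ℝ => -(t / (2 * π))) atTop atBot :=
      tendsto_neg_atTop_atBot.comp (tendsto_id.atTop_div_const (by positivity))
    exact this.mono_right atBot_le_cocompact
  refine (hRL.comp hw).congr fun t => ?_
  simp only [Function.comp]
  have h1 : ∀ v : ℝ, (Real.fourierChar (-(v * -(t / (2 * π))))) • F v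
      = (Real.cos '' s).indicator (fun u => Complex.exp ((t * u : ℝ) * Complex.I) *
        ((|Real.sin (g u)|⁻¹ : ℝ) • f (g u))) v := by
    intro v
    by_cases hv : v ∈ Real.cos '' s
    · rw [hF, Set.indicator_of_mem hv, Set.indicator_of_mem hv, Circle.smul_def,
        Real.fourierChar_apply, smul_eq_mul]
      congr 4
      field_simp
    · simp [hF, Set.indicator_of_notMem hv]
  simp_rw [h1]
  rw [integral_indicator him, integral_image_eq_integral_abs_deriv_smul hs
    (fun x _ => (Real.hasDerivAt_cos x).hasDerivWithinAt) hi]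
  refine setIntegral_congr_fun hs fun x hx => ?_
  have := abs_ne_zero.mpr (h0 x hx)
  simp only [hgl x hx, abs_neg, Complex.real_smul]
  have h2 : ((|Real.sin x| : ℝ) : ℂ) ≠ 0 := by exact_mod_cast this
  rw [Complex.ofReal_inv]
  field_simp

lemma aux_B (s : Set ℝ) (hs : MeasurableSet s) (hi : Set.InjOn Real.cos s)
    (h0 : ∀ x ∈ s, Real.sin x ≠ 0) (a : ℝ) (f : ℝ → ℝ) (hf : IntegrableOn f s) :
    Tendsto (fun t : ℝ => ∫ x in s, Real.sin (a + t * Real.cos x) * f x)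
      atTop (nhds 0) := by
  have hA := aux_A s hs hi h0 (fun x => Complex.exp (a * Complex.I) * f x)
  have := (Complex.continuous_im.tendsto 0).comp hA
  rw [Complex.zero_im] at this
  refine this.congr fun t => ?_
  simp only [Function.comp]
  have hfc : IntegrableOn (fun x => (f x : ℂ)) s := hf.ofReal
  have hint : IntegrableOn (fun x => Complex.exp ((t * Real.cos x : ℝ) * Complex.I) *
      (Complex.exp (a * Complex.I) * f x)) s := by
    refine Integrable.bdd_mul (c := 1) (hfc.const_mul _) (by fun_prop) ?_
    exact Eventually.of_forall fun x => (Complex.norm_exp_ofReal_mul_I _).le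
  have := integral_im hint
  simp only [RCLike.im_to_complex] at this
  rw [← this]
  refine setIntegral_congr_fun hs fun x hx => ?_
  rw [← mul_assoc, ← Complex.exp_add, Complex.im_mul_ofReal, ← add_mul, ← Complex.ofReal_add,
    Complex.exp_ofReal_mul_I_im, add_comm]

lemma aux_C (a : ℝ) (f : ℝ → ℝ) (hf : IntegrableOn f (Set.Icc 0 (2*π))) :
    Tendsto (fun t : ℝ => ∫ x in Set.Icc 0 (2*π), Real.sin (a + t * Real.cos x) * f x)
      atTop (nhds 0) := by
  have hp := Real.pi_pos
  have h1 := aux_B (Set.Ioo 0 π) measurableSet_Ioo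
    (Real.injOn_cos.mono Set.Ioo_subset_Icc_self) (fun x hx => (Real.sin_pos_of_mem_Ioo hx).ne') a f
    (hf.mono_set fun x hx => ⟨hx.1.le, by linarith [hx.2]⟩)
  have h2 := aux_B (Set.Ioo π (2*π)) measurableSet_Ioo
    (fun x hx y hy h => by
      have := Real.injOn_cos (x₁ := 2*π - x) (x₂ := 2*π - y)
        ⟨by linarith [hx.2], by linarith [hx.1]⟩ ⟨by linarith [hy.2], by linarith [hy.1]⟩
        (by simpa [Real.cos_two_pi_sub] using h)
      linarith)
    (fun x hx => by
      have := Real.sin_pos_of_mem_Ioo (x := 2*π - x) ⟨by linarith [hx.2], by linarith [hx.1]⟩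
      rw [Real.sin_two_pi_sub] at this
      linarith) a f
    (hf.mono_set fun x hx => ⟨by linarith [hx.1], hx.2.le⟩)
  have h3 := h1.add h2
  rw [add_zero] at h3
  refine h3.congr fun t => ?_
  have hint : IntegrableOn (fun x => Real.sin (a + t * Real.cos x) * f x) (Set.Icc 0 (2*π)) := by
    refine Integrable.bdd_mul (c := 1) hf (by fun_prop) ?_
    exact Eventually.of_forall fun x => Real.abs_sin_le_one _
  rw [integral_Icc_eq_integral_Ioc, ← integral_Ioc_eq_integral_Ioo, ← integral_Ioc_eq_integral_Ioo,
    ← Set.Ioc_union_Ioc_eq_Ioc hp.le (by linarith : π ≤ 2*π),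
    setIntegral_union (Set.Ioc_disjoint_Ioc_of_le le_rfl) measurableSet_Ioc]
  · exact hint.mono_set fun x hx => ⟨hx.1.le, by linarith [hx.2]⟩
  · exact hint.mono_set fun x hx => ⟨by linarith [hx.1], hx.2⟩

lemma aux_D {β : Type*} [MeasurableSpace β] (μ : Measure ℝ) (ν : Measure β) [SFinite μ] [SFinite ν]
    (k : ℝ → ℝ × β → ℝ) (hk : ∀ t, Measurable (k t)) (hb : ∀ t x, |k t x| ≤ 1)
    (φ : ℝ × β → ℝ) (hφ : Integrable φ (μ.prod ν))
    (h : ∀ x, Integrable (fun y => φ (x, y)) ν →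
      Tendsto (fun t => ∫ y, k t (x, y) * φ (x, y) ∂ν) atTop (nhds 0)) :
    Tendsto (fun t => ∫ z, k t z * φ z ∂(μ.prod ν)) atTop (nhds 0) := by
  have hint : ∀ t, Integrable (fun z => k t z * φ z) (μ.prod ν) := fun t =>
    Integrable.bdd_mul (c := 1) hφ (hk t).aestronglyMeasurable (Eventually.of_forall (hb t))
  have : Tendsto (fun t => ∫ x, ∫ y, k t (x, y) * φ (x, y) ∂ν ∂μ) atTop
      (nhds (∫ x, (0:ℝ) ∂μ)) := by
    refine tendsto_integral_filter_of_dominated_convergence (fun x => ∫ y, ‖φ (x, y)‖ ∂ν)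
      ?_ ?_ ?_ ?_
    · exact Eventually.of_forall fun t => (hint t).integral_prod_left.aestronglyMeasurable
    · refine Eventually.of_forall fun t => ?_
      filter_upwards [hφ.prod_right_ae] with x hx
      refine norm_integral_le_of_norm_le hx.norm (Eventually.of_forall fun y => ?_)
      rw [norm_mul]
      exact mul_le_of_le_one_left (norm_nonneg _) (hb t _)
    · exact hφ.integral_norm_prod_left
    · filter_upwards [hφ.prod_right_ae] with x hx using h x hx
  rw [integral_zero] at this
  exact this.congr fun t => (integral_prod _ (hint t)).symm

/-- Weak convergence to the Kolmogorov flow: for `λ ∈ ℤ` and `φ` integrable on the cube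
`[0,2π]³`, the oscillatory integral `∫_{[0,2π]³} sin(λx₁+x₂+t cos x₃) φ(x) dx` tends
to `0` as `t → ∞`. -/
theorem stmt_11 (lam : ℤ) (φ : ℝ × ℝ × ℝ → ℝ)
    (hφ : IntegrableOn φ
      (Set.Icc 0 (2*π) ×ˢ Set.Icc 0 (2*π) ×ˢ Set.Icc 0 (2*π))) :
    Tendsto (fun t : ℝ =>
        ∫ x in (Set.Icc 0 (2*π) ×ˢ Set.Icc 0 (2*π) ×ˢ Set.Icc (0:ℝ) (2*π)),
          Real.sin ((lam:ℝ) * x.1 + x.2.1 + t * Real.cos x.2.2) * φ x)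
      atTop (nhds 0) := by
  have hm : (volume : Measure (ℝ × ℝ × ℝ)).restrict
      (Set.Icc 0 (2*π) ×ˢ Set.Icc 0 (2*π) ×ˢ Set.Icc (0:ℝ) (2*π)) =
      ((volume : Measure ℝ).restrict (Set.Icc 0 (2*π))).prod
        (((volume : Measure ℝ).restrict (Set.Icc 0 (2*π))).prod
          ((volume : Measure ℝ).restrict (Set.Icc 0 (2*π)))) := by
    rw [Measure.prod_restrict, Measure.prod_restrict, ← Measure.volume_eq_prod,
      ← Measure.volume_eq_prod]
  unfold IntegrableOn at hφ
  rw [hm] at hφ ⊢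
  generalize hμ : (volume : Measure ℝ).restrict (Set.Icc 0 (2*π)) = μ at hφ ⊢
  haveI : SFinite μ := by rw [← hμ]; infer_instance
  refine aux_D μ (μ.prod μ) (fun t x => Real.sin ((lam:ℝ) * x.1 + x.2.1 + t * Real.cos x.2.2))
    (fun t => by fun_prop) (fun t x => Real.abs_sin_le_one _) φ hφ fun x hx => ?_
  refine aux_D μ μ (fun t y => Real.sin ((lam:ℝ) * x + y.1 + t * Real.cos y.2))
    (fun t => by fun_prop) (fun t x => Real.abs_sin_le_one _) (fun y => φ (x, y)) hx fun y hy => ?_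
  subst hμ
  exact aux_C ((lam:ℝ) * x + y) (fun z => φ (x, y, z)) hy
end

section
/- Favorable initial pressure for the initial data of Theorem B: let N > 1 and define u : ℝ³ → ℝ³ by u(x) = ( cos x₂ · N/(N+sin x₃), cos x₁ · (N+sin x₃)/N, 0 ). Then: (i) ∑_{k=1}^3 ∂_{x_k} u_k(x) = 0 for all x; (ii) ∑_{i,j=1}^3 ∂_{x_i} u_j(x) · ∂_{x_j} u_i(x) = 2 sin x₁ sin x₂ for all x; and (iii) the function P(x) = sin x₁ sin x₂ satisfies −ΔP(x) = ∑_{i,j=1}^3 ∂_{x_i} u_j(x) · ∂_{x_j} u_i(x) and ∂_{x₃} P(x) = 0 for all x. -/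
open Real

/-- The initial data of Theorem B:
`u(x) = (cos x₂ · N/(N+sin x₃), cos x₁ · (N+sin x₃)/N, 0)`. -/
noncomputable def uThmB (N : ℝ) (x : Fin 3 → ℝ) : Fin 3 → ℝ :=
  ![Real.cos (x 1) * (N / (N + Real.sin (x 2))),
    Real.cos (x 0) * ((N + Real.sin (x 2)) / N),
    0]

/-- Favorable initial pressure for the initial data of Theorem B: for `N > 1`, the field
`u` is divergence free, its pressure source `∑_{i,j} ∂_i u_j ∂_j u_i` equals
`2 sin x₁ sin x₂`, and `P(x) = sin x₁ sin x₂` satisfies `-ΔP = ∑_{i,j} ∂_i u_j ∂_j u_i`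
with `∂₃ P = 0`. -/
theorem stmt_17 (N : ℝ) (hN : 1 < N) :
    (∀ x : Fin 3 → ℝ, ∑ k : Fin 3, pd (fun y => uThmB N y k) k x = 0) ∧
    (∀ x : Fin 3 → ℝ,
      ∑ i : Fin 3, ∑ j : Fin 3,
          pd (fun y => uThmB N y j) i x * pd (fun y => uThmB N y i) j x =
        2 * Real.sin (x 0) * Real.sin (x 1)) ∧
    (∀ x : Fin 3 → ℝ,
      (-(∑ k : Fin 3,
          pd (fun y => pd (fun z => Real.sin (z 0) * Real.sin (z 1)) k y) k x) =
        ∑ i : Fin 3, ∑ j : Fin 3,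
          pd (fun y => uThmB N y j) i x * pd (fun y => uThmB N y i) j x) ∧
      pd (fun y => Real.sin (y 0) * Real.sin (y 1)) 2 x = 0) := by
  have hN0 : N ≠ 0 := by linarith
  have hD : ∀ t : ℝ, N + Real.sin t ≠ 0 := fun t => by
    have := Real.neg_one_le_sin t
    linarith
  have h00 : ∀ x, pd (fun y => uThmB N y 0) 0 x = 0 := fun x => by
    simp [pd, uThmB, Function.update]
  have h01 : ∀ x, pd (fun y => uThmB N y 0) 1 x
      = -Real.sin (x 1) * (N / (N + Real.sin (x 2))) := fun x => by
    simp [pd, uThmB, Function.update]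
  have h10 : ∀ x, pd (fun y => uThmB N y 1) 0 x
      = -Real.sin (x 0) * ((N + Real.sin (x 2)) / N) := fun x => by
    simp [pd, uThmB, Function.update]
  have h11 : ∀ x, pd (fun y => uThmB N y 1) 1 x = 0 := fun x => by
    simp [pd, uThmB, Function.update]
  have h2 : ∀ k x, pd (fun y => uThmB N y 2) k x = 0 := fun k x => by
    simp [pd, uThmB]
  have hs : ∀ x : Fin 3 → ℝ,
      ∑ i : Fin 3, ∑ j : Fin 3,
          pd (fun y => uThmB N y j) i x * pd (fun y => uThmB N y i) j x =
        2 * Real.sin (x 0) * Real.sin (x 1) := fun x => by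
    simp only [Fin.sum_univ_three, h00, h01, h10, h11, h2]
    have h1 := hD (x 2)
    field_simp
    ring
  have p0 : ∀ x, pd (fun z => Real.sin (z 0) * Real.sin (z 1)) 0 x
      = Real.cos (x 0) * Real.sin (x 1) := fun x => by
    simp [pd, Function.update]
  have p1 : ∀ x, pd (fun z => Real.sin (z 0) * Real.sin (z 1)) 1 x
      = Real.sin (x 0) * Real.cos (x 1) := fun x => by
    simp [pd, Function.update]
  have p2 : ∀ x, pd (fun z => Real.sin (z 0) * Real.sin (z 1)) 2 x = 0 := fun x => by
    simp [pd, Function.update]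
  have q0 : ∀ x, pd (fun z => Real.cos (z 0) * Real.sin (z 1)) 0 x
      = -Real.sin (x 0) * Real.sin (x 1) := fun x => by
    simp [pd, Function.update]
  have q1 : ∀ x, pd (fun z => Real.sin (z 0) * Real.cos (z 1)) 1 x
      = -Real.sin (x 0) * Real.sin (x 1) := fun x => by
    simp [pd, Function.update]
  have q2 : ∀ x, pd (fun _ => (0 : ℝ)) 2 x = 0 := fun x => by
    simp [pd]
  refine ⟨fun x => ?_, hs, fun x => ⟨?_, p2 x⟩⟩
  · simp only [Fin.sum_univ_three, h00, h11, h2, add_zero]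
  · rw [hs]
    simp only [Fin.sum_univ_three, p0, p1, p2, q0, q1, q2]
    ring
end
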